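/- arXiv:2009.08419 — 3 statements merged into one kernel-verified Lean document; each statement's English description precedes it below -/
import Mathlib

section
/- Let k ≥ 3 be an odd integer and let a be an odd integer. Then G(a/2^k) = 2^{(k+1)/2} e^{2πi a/8}. -/
open Complex Real BigOperators

/-- The quadratic Gauss sum `G(a/c) = ∑_{x=0}^{c-1} e^{2πi a x² / c}`. -/
noncomputable def quadGaussSum (a : ℤ) (c : ℕ) : ℂ :=
  ∑ x ∈ Finset.range c, Complex.exp (2 * Real.pi * Complex.I * a * (x : ℂ) ^ 2 / c)

theorem sum_range_two_mul_eq_sum_even_add_odd (f : ℕ → ℂ) (n : ℕ) :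
    ∑ x ∈ Finset.range (2 * n), f x =
      ∑ y ∈ Finset.range n, f (2 * y) + ∑ y ∈ Finset.range n, f (2 * y + 1) := by
  induction n with
  | zero => simp
  | succ n ih =>
    rw [mul_add, mul_one, Finset.sum_range_succ, Finset.sum_range_succ, ih,
      Finset.sum_range_succ, Finset.sum_range_succ]
    ring

theorem sum_range_two_mul_of_antiperiodic (f : ℕ → ℂ) (n : ℕ) (hf : ∀ x, f (n + x) = -f x) :
    ∑ x ∈ Finset.range (2 * n), f x = 0 := by
  simp [two_mul, Finset.sum_range_add, hf]

theorem sum_range_two_mul_of_periodic (f : ℕ → ℂ) (n : ℕ) (hf : ∀ x, f (n + x) = f x) :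
    ∑ x ∈ Finset.range (2 * n), f x = 2 * ∑ x ∈ Finset.range n, f x := by
  rw [two_mul, Finset.sum_range_add, two_mul]
  simp [hf]

/-- For odd `a`, the Gauss sum doubles when a modulus divisible by `4` is multiplied by `4`. -/
theorem quadGaussSum_sixteen_mul (a : ℤ) (ha : Odd a) (m : ℕ) (hm : m ≠ 0) :
    quadGaussSum a (16 * m) = 2 * quadGaussSum a (4 * m) := by
  have hm' : (m : ℂ) ≠ 0 := Nat.cast_ne_zero.mpr hm
  have hodd : ∑ y ∈ Finset.range (2 * (4 * m)),
      Complex.exp (2 * Real.pi * Complex.I * a * ((2 * y + 1 : ℕ) : ℂ) ^ 2 / (16 * m : ℕ)) = 0 := by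
    rw [show 2 * (4 * m) = 2 * (2 * m) + 2 * (2 * m) by ring, Finset.sum_range_add]
    have key : ∀ x : ℕ,
        Complex.exp (2 * Real.pi * Complex.I * a * ((2 * (2 * m + x) + 1 : ℕ) : ℂ) ^ 2 /
          (16 * m : ℕ)) =
        -Complex.exp (2 * Real.pi * Complex.I * a * ((2 * x + 1 : ℕ) : ℂ) ^ 2 / (16 * m : ℕ)) := by
      intro x
      obtain ⟨b, rfl⟩ := ha
      rw [← mul_neg_one, ← Complex.exp_pi_mul_I, ← Complex.exp_add,
        Complex.exp_eq_exp_iff_exists_int]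
      refine ⟨(2 * b + 1) * (m + x) + b, ?_⟩
      push_cast
      field_simp
      ring
    rw [sum_range_two_mul_of_antiperiodic _ _ key]
    rw [zero_add]
    refine sum_range_two_mul_of_antiperiodic
      (fun x ↦ Complex.exp (2 * Real.pi * Complex.I * a *
        ((2 * (2 * (2 * m) + x) + 1 : ℕ) : ℂ) ^ 2 / (16 * m : ℕ))) _ fun x ↦ ?_
    rw [← key, add_left_comm]
  have heven : ∀ y : ℕ,
      Complex.exp (2 * Real.pi * Complex.I * a * ((2 * y : ℕ) : ℂ) ^ 2 / (16 * m : ℕ)) =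
      Complex.exp (2 * Real.pi * Complex.I * a * (y : ℂ) ^ 2 / (4 * m : ℕ)) := by
    intro y
    congr 1
    push_cast
    field_simp
    ring
  rw [quadGaussSum, show 16 * m = 2 * (2 * (4 * m)) by ring,
    sum_range_two_mul_eq_sum_even_add_odd, show 2 * (2 * (4 * m)) = 16 * m by ring, hodd, add_zero]
  simp_rw [heven]
  refine sum_range_two_mul_of_periodic
    (fun y ↦ Complex.exp (2 * Real.pi * Complex.I * a * (y : ℂ) ^ 2 / (4 * m : ℕ))) _ fun x ↦ ?_
  rw [Complex.exp_eq_exp_iff_exists_int]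
  refine ⟨a * (2 * x + 4 * m), ?_⟩
  push_cast
  field_simp
  ring

theorem quadGaussSum_eight (a : ℤ) (ha : Odd a) :
    quadGaussSum a 8 = 4 * Complex.exp (2 * Real.pi * Complex.I * a / 8) := by
  have key : ∀ n q : ℕ, ∀ r : ℂ, (n : ℂ) ^ 2 = 8 * q + r →
      Complex.exp (2 * Real.pi * Complex.I * a * (n : ℂ) ^ 2 / (8 : ℕ)) =
        Complex.exp (2 * Real.pi * Complex.I * a * r / 8) := by
    intro n q r h
    rw [h, Complex.exp_eq_exp_iff_exists_int]
    refine ⟨a * q, ?_⟩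
    push_cast
    ring
  have h4 : Complex.exp (2 * Real.pi * Complex.I * a * 4 / 8) = -1 := by
    obtain ⟨b, rfl⟩ := ha
    rw [← Complex.exp_pi_mul_I, Complex.exp_eq_exp_iff_exists_int]
    refine ⟨b, ?_⟩
    push_cast
    ring
  simp only [quadGaussSum, Finset.sum_range_succ, Finset.sum_range_zero]
  rw [key 0 0 0 (by norm_num), key 1 0 1 (by norm_num), key 2 0 4 (by norm_num),
    key 3 1 1 (by norm_num), key 4 2 0 (by norm_num), key 5 3 1 (by norm_num),
    key 6 4 4 (by norm_num), key 7 6 1 (by norm_num), h4]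
  simp only [mul_zero, zero_div, Complex.exp_zero, mul_one]
  ring

/-- for odd `k ≥ 3` and odd `a`,
`G(a/2^k) = 2^{(k+1)/2} e^{2πi a / 8}`. -/
theorem quadGaussSum_two_pow_odd (k : ℕ) (hk : 3 ≤ k) (hko : Odd k)
    (a : ℤ) (ha : Odd a) :
    quadGaussSum a (2 ^ k) =
      (2 : ℂ) ^ ((k + 1) / 2) * Complex.exp (2 * Real.pi * Complex.I * a / 8) := by
  obtain ⟨j, rfl⟩ := hko
  obtain ⟨n, rfl⟩ : ∃ n, j = n + 1 := ⟨j - 1, by omega⟩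
  clear hk
  rw [show (2 * (n + 1) + 1 + 1) / 2 = n + 2 by omega]
  induction n with
  | zero => norm_num [quadGaussSum_eight a ha]
  | succ n ih =>
    rw [show 2 ^ (2 * (n + 1 + 1) + 1) = 16 * 2 ^ (2 * n + 1) by ring,
      quadGaussSum_sixteen_mul a ha _ (by positivity),
      show 4 * 2 ^ (2 * n + 1) = 2 ^ (2 * (n + 1) + 1) by ring, ih]
    ring
end

section
/- Let c = 2^k c₀ where k ≥ 2 and c₀ is an odd positive integer, let a be an integer with gcd(a,c) = 1, and let δ ∈ {0,1} be the residue of k modulo 2. Then G(a/c) = ε_{c₀} · √c · (a·2^δ / c₀) · F, where F = 1 + e^{2πi a c₀ / 4} if δ = 0, and F = √2 · e^{2πi a c₀ / 8} if δ = 1. -/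
open Complex Real BigOperators

/-- `ε_n = 1` if `n ≡ 1 (mod 4)` and `ε_n = i` if `n ≡ 3 (mod 4)`. -/
noncomputable def epsFactor (n : ℕ) : ℂ := if n % 4 = 1 then 1 else Complex.I

/-- The additive character `z ↦ e^{2πiz}`. -/
noncomputable def unitExp (z : ℂ) : ℂ := cexp (2 * π * I * z)

lemma unitExp_add (z w : ℂ) : unitExp (z + w) = unitExp z * unitExp w := by
  rw [unitExp, mul_add, Complex.exp_add, unitExp, unitExp]

lemma unitExp_intCast (n : ℤ) : unitExp n = 1 := by
  rw [unitExp, mul_comm, Complex.exp_int_mul_two_pi_mul_I]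

lemma unitExp_eq_of_eq_add_int {z w : ℂ} (n : ℤ) (h : z = w + n) : unitExp z = unitExp w := by
  rw [h, unitExp_add, unitExp_intCast, mul_one]

lemma unitExp_half : unitExp (1 / 2) = -1 := by
  rw [unitExp, ← Complex.exp_pi_mul_I]
  congr 1
  ring

lemma unitExp_int_div (j : ℤ) (N : ℕ) [NeZero N] :
    unitExp (j / N) = ZMod.stdAddChar (j : ZMod N) := by
  rw [ZMod.stdAddChar_coe, unitExp]
  congr 1
  ring

lemma quadGaussSum_eq_sum_unitExp (a : ℤ) (c : ℕ) :
    quadGaussSum a c = ∑ x ∈ Finset.range c, unitExp (a * (x : ℂ) ^ 2 / c) := by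
  refine Finset.sum_congr rfl fun x _ => ?_
  rw [unitExp]
  congr 1
  ring

lemma ZMod.sum_eq_sum_range {M : Type*} [AddCommMonoid M] (N : ℕ) [NeZero N] (f : ZMod N → M) :
    ∑ x, f x = ∑ x ∈ Finset.range N, f x := by
  symm
  refine Finset.sum_nbij' (fun x => (x : ZMod N)) ZMod.val (by simp) (fun x _ => ?_)
    (fun x hx => ?_) (by simp) (by simp)
  · simpa using ZMod.val_lt x
  · exact ZMod.val_cast_of_lt (by simpa using hx)

lemma quadGaussSum_eq_sum_zmod (a : ℤ) (c : ℕ) [NeZero c] :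
    quadGaussSum a c = ∑ x : ZMod c, ZMod.stdAddChar ((a : ZMod c) * x ^ 2) := by
  rw [ZMod.sum_eq_sum_range, quadGaussSum_eq_sum_unitExp]
  refine Finset.sum_congr rfl fun x _ => ?_
  have := unitExp_int_div (a * (x : ℤ) ^ 2) c
  push_cast at this
  exact this

lemma Finset.sum_range_mul_eq {M : Type*} [AddCommMonoid M] (f : ℕ → M) (m n : ℕ) :
    ∑ x ∈ Finset.range (m * n), f x =
      ∑ y ∈ Finset.range m, ∑ z ∈ Finset.range n, f (y + m * z) := by
  rw [Finset.sum_comm]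
  induction n with
  | zero => simp
  | succ n ih =>
    rw [mul_add, mul_one, Finset.sum_range_add, ih, Finset.sum_range_succ]
    simp [add_comm]

lemma bijective_mul_add_mul_zmod {m n : ℕ} [NeZero m] [NeZero n] (h : m.Coprime n) :
    Function.Bijective
      fun p : Fin m × Fin n => (n * (p.1 : ℕ) + m * (p.2 : ℕ) : ZMod (m * n)) := by
  rw [Fintype.bijective_iff_injective_and_card]
  refine ⟨?_, by simp [ZMod.card]⟩
  rintro ⟨y, z⟩ ⟨y', z'⟩ hyz
  have hyz : n * (y : ℕ) + m * z ≡ n * y' + m * z' [MOD m * n] := by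
    rw [← ZMod.natCast_eq_natCast_iff]
    exact_mod_cast hyz
  have h1 : n * (y : ℕ) ≡ n * y' [MOD m] := by
    have := hyz.of_mul_right n
    simpa [Nat.ModEq, Nat.add_mul_mod_self_left] using this
  have h2 : m * (z : ℕ) ≡ m * z' [MOD n] := by
    have := hyz.of_mul_left m
    simpa [Nat.ModEq, Nat.mul_add_mod] using this
  have h1 := (Nat.ModEq.cancel_left_of_coprime h h1).eq_of_lt_of_lt y.2 y'.2
  have h2 := (Nat.ModEq.cancel_left_of_coprime h.symm h2).eq_of_lt_of_lt z.2 z'.2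
  exact Prod.ext (Fin.ext h1) (Fin.ext h2)

lemma quadGaussSum_mul (a : ℤ) {m n : ℕ} (hm : m ≠ 0) (hn : n ≠ 0) (h : m.Coprime n) :
    quadGaussSum a (m * n) = quadGaussSum (a * n) m * quadGaussSum (a * m) n := by
  have : NeZero m := ⟨hm⟩
  have : NeZero n := ⟨hn⟩
  have hm' : (m : ℂ) ≠ 0 := by exact_mod_cast hm
  have hn' : (n : ℂ) ≠ 0 := by exact_mod_cast hn
  rw [quadGaussSum_eq_sum_zmod, ← (bijective_mul_add_mul_zmod h).sum_comp,
    Fintype.sum_prod_type, quadGaussSum_eq_sum_unitExp, quadGaussSum_eq_sum_unitExp,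
    Finset.sum_mul_sum, Finset.sum_range]
  refine Finset.sum_congr rfl fun y _ => ?_
  rw [Finset.sum_range]
  refine Finset.sum_congr rfl fun z _ => ?_
  have := unitExp_int_div (a * (n * (y : ℕ) + m * (z : ℕ)) ^ 2) (m * n)
  push_cast at this ⊢
  rw [← this, ← unitExp_add]
  refine unitExp_eq_of_eq_add_int (2 * a * y * z) ?_
  push_cast
  field_simp
  ring

lemma quadGaussSum_prime {p : ℕ} (hp : p.Prime) (hp2 : p ≠ 2) {a : ℤ} (ha : ¬ (p : ℤ) ∣ a) :
    quadGaussSum a p = jacobiSym a p * quadGaussSum 1 p := by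
  have : Fact p.Prime := ⟨hp⟩
  have key (b : ℤ) (hb : ¬ (p : ℤ) ∣ b) : quadGaussSum b p =
      ∑ t : ZMod p, (quadraticChar (ZMod p) t : ℂ) * ZMod.stdAddChar ((b : ZMod p) * t) := by
    have hb' : (b : ZMod p) ≠ 0 := by rwa [Ne, ZMod.intCast_zmod_eq_zero_iff_dvd]
    have h0 : ∑ t : ZMod p, (ZMod.stdAddChar ((b : ZMod p) * t) : ℂ) = 0 := by
      have := AddChar.sum_mulShift (R := ZMod p) (b : ZMod p) (ZMod.isPrimitive_stdAddChar p)
      simpa [hb', mul_comm] using this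
    rw [quadGaussSum_eq_sum_zmod, ← Finset.sum_fiberwise Finset.univ (fun x : ZMod p => x ^ 2)]
    rw [← add_zero (∑ t : ZMod p, (quadraticChar (ZMod p) t : ℂ) * _), ← h0,
      ← Finset.sum_add_distrib]
    refine Finset.sum_congr rfl fun t _ => ?_
    rw [Finset.sum_congr rfl (g := fun _ => (ZMod.stdAddChar ((b : ZMod p) * t) : ℂ))
      (fun x hx => by rw [(Finset.mem_filter.1 hx).2]), Finset.sum_const, nsmul_eq_mul]
    have hc := quadraticChar_card_sqrts (F := ZMod p) (by rwa [ZMod.ringChar_zmod_n]) t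
    have hc' : (((Finset.univ.filter fun x : ZMod p => x ^ 2 = t).card : ℤ) : ℂ) =
        (quadraticChar (ZMod p) t : ℂ) + 1 := by
      rw [← Int.cast_one, ← Int.cast_add, ← hc]
      congr 3
      ext x
      simp
    rw [Int.cast_natCast] at hc'
    rw [hc']
    ring
  have ha' : (a : ZMod p) ≠ 0 := by rwa [Ne, ZMod.intCast_zmod_eq_zero_iff_dvd]
  rw [key a ha, key 1 (by exact_mod_cast hp.not_dvd_one), ← jacobiSym.legendreSym.to_jacobiSym, legendreSym,
    Finset.mul_sum, ← (mulLeft_bijective₀ _ ha').sum_comp fun t : ZMod p =>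
      (quadraticChar (ZMod p) a : ℂ) * ((quadraticChar (ZMod p) t : ℂ) *
        ZMod.stdAddChar (((1 : ℤ) : ZMod p) * t))]
  refine Finset.sum_congr rfl fun t _ => ?_
  have h1 : (quadraticChar (ZMod p) a : ℂ) ^ 2 = 1 := by
    exact_mod_cast quadraticChar_sq_one ha'
  rw [map_mul (quadraticChar (ZMod p)), Int.cast_one, one_mul, Int.cast_mul]
  linear_combination -(quadraticChar (ZMod p) t : ℂ) * ZMod.stdAddChar ((a : ZMod p) * t) * h1

lemma sum_range_unitExp_int_mul_div (p : ℕ) [NeZero p] (b : ℤ) :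
    ∑ z ∈ Finset.range p, unitExp (b * z / p) = if (p : ℤ) ∣ b then (p : ℂ) else 0 := by
  have := AddChar.sum_mulShift (R := ZMod p) (b : ZMod p) (ZMod.isPrimitive_stdAddChar p)
  rw [ZMod.sum_eq_sum_range] at this
  simp only [ZMod.intCast_zmod_eq_zero_iff_dvd, ZMod.card] at this
  rw [Nat.cast_ite, Nat.cast_zero] at this
  rw [← this]
  refine Finset.sum_congr rfl fun x _ => ?_
  have := unitExp_int_div (b * x) p
  push_cast at this
  rw [this, mul_comm]

lemma quadGaussSum_prime_sq_mul {p : ℕ} (hp : p.Prime) (hp2 : p ≠ 2) {a : ℤ}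
    (ha : ¬ (p : ℤ) ∣ a) (M : ℕ) (hM : M ≠ 0) :
    quadGaussSum a (p ^ 2 * M) = p * quadGaussSum a M := by
  have : NeZero p := ⟨hp.ne_zero⟩
  have hp' : (p : ℂ) ≠ 0 := by exact_mod_cast hp.ne_zero
  have hM' : (M : ℂ) ≠ 0 := by exact_mod_cast hM
  have inner (y : ℕ) : ∑ z ∈ Finset.range p,
      unitExp (a * ((y + p * M * z : ℕ) : ℂ) ^ 2 / (p ^ 2 * M : ℕ)) =
      if p ∣ y then p * unitExp (a * (y : ℂ) ^ 2 / (p ^ 2 * M : ℕ)) else 0 := by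
    have h1 : ((p : ℤ) ∣ 2 * a * y) ↔ p ∣ y := by
      have hpi : Prime (p : ℤ) := Nat.prime_iff_prime_int.1 hp
      rw [hpi.dvd_mul, hpi.dvd_mul, Int.natCast_dvd_natCast]
      have : ¬ (p : ℤ) ∣ 2 := by
        intro h
        exact hp2 ((Nat.prime_dvd_prime_iff_eq hp Nat.prime_two).1 (by exact_mod_cast h))
      tauto
    have h2 := sum_range_unitExp_int_mul_div p (2 * a * y)
    rw [if_congr h1 rfl rfl] at h2
    rw [← mul_zero (unitExp (a * (y : ℂ) ^ 2 / (p ^ 2 * M : ℕ))), mul_comm (p : ℂ),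
      ← mul_ite, ← h2, Finset.mul_sum]
    refine Finset.sum_congr rfl fun z _ => ?_
    rw [← unitExp_add]
    refine unitExp_eq_of_eq_add_int (a * M * z ^ 2) ?_
    push_cast
    field_simp
    ring
  rw [quadGaussSum_eq_sum_unitExp, quadGaussSum_eq_sum_unitExp, Finset.mul_sum]
  rw [show Finset.range (p ^ 2 * M) = Finset.range (p * M * p) by congr 1; ring,
    Finset.sum_range_mul_eq, Finset.sum_congr rfl fun y _ => inner y, Finset.sum_range_mul_eq,
    Finset.sum_eq_single 0]
  · refine Finset.sum_congr rfl fun z _ => ?_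
    rw [if_pos (by simp)]
    congr 2
    push_cast
    field_simp
    ring
  · intro y hy hy0
    refine Finset.sum_eq_zero fun z _ => if_neg fun h => ?_
    rw [Nat.dvd_add_left (dvd_mul_right _ _)] at h
    exact hy0 (Nat.eq_zero_of_dvd_of_lt h (Finset.mem_range.1 hy))
  · intro h
    exact absurd (Finset.mem_range.2 hp.pos) h

lemma quadGaussSum_one (a : ℤ) : quadGaussSum a 1 = 1 := by
  simp [quadGaussSum]

lemma quadGaussSum_prime_pow {p : ℕ} (hp : p.Prime) (hp2 : p ≠ 2) {a : ℤ}
    (ha : ¬ (p : ℤ) ∣ a) (k : ℕ) :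
    quadGaussSum a (p ^ k) = jacobiSym a (p ^ k) * quadGaussSum 1 (p ^ k) := by
  have hp0 := hp.ne_zero
  have h1 : ¬ (p : ℤ) ∣ 1 := by exact_mod_cast hp.not_dvd_one
  induction k using Nat.twoStepInduction with
  | zero => simp [quadGaussSum_one]
  | one => simpa using quadGaussSum_prime hp hp2 ha
  | more k ih _ =>
    have hc : Int.gcd a p = 1 := by
      rw [Int.gcd_comm]
      exact (Int.isCoprime_iff_gcd_eq_one.1
        ((Nat.prime_iff_prime_int.1 hp).coprime_iff_not_dvd.2 ha))
    rw [add_comm, pow_add, quadGaussSum_prime_sq_mul hp hp2 ha _ (pow_ne_zero _ hp0),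
      quadGaussSum_prime_sq_mul hp hp2 h1 _ (pow_ne_zero _ hp0), ih,
      jacobiSym.mul_right' _ (pow_ne_zero _ hp0) (pow_ne_zero _ hp0), jacobiSym.pow_right a p 2,
      jacobiSym.sq_one hc]
    push_cast
    ring

lemma quadGaussSum_eq_jacobiSym_mul {n : ℕ} (hn : Odd n) {a : ℤ} (ha : IsCoprime a n) :
    quadGaussSum a n = jacobiSym a n * quadGaussSum 1 n := by
  induction n using Nat.recOnPosPrimePosCoprime generalizing a with
  | zero => simp at hn
  | one => simp [quadGaussSum_one]
  | prime_pow p k hp hk =>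
    refine quadGaussSum_prime_pow hp ?_ ?_ k
    · rintro rfl
      exact absurd hn (by simp [Nat.odd_pow_iff hk.ne', Nat.not_odd_iff_even])
    · intro h
      push_cast at ha
      exact (Nat.prime_iff_prime_int.1 hp).not_isUnit
        (((IsCoprime.pow_right_iff hk).1 ha).isUnit_of_dvd' h dvd_rfl)
  | coprime m n hm hn' hmn ihm ihn =>
    obtain ⟨ho1, ho2⟩ := Nat.odd_mul.1 hn
    have hm0 : m ≠ 0 := by omega
    have hn0 : n ≠ 0 := by omega
    have hi : IsCoprime (m : ℤ) n := Nat.isCoprime_iff_coprime.2 hmn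
    push_cast at ha
    have ha1 := ha.of_mul_right_left
    have ha2 := ha.of_mul_right_right
    rw [quadGaussSum_mul _ hm0 hn0 hmn, quadGaussSum_mul _ hm0 hn0 hmn, one_mul, one_mul,
      ihm ho1 (ha1.mul_left hi.symm), ihn ho2 (ha2.mul_left hi), ihm ho1 hi.symm, ihn ho2 hi,
      jacobiSym.mul_left, jacobiSym.mul_left, jacobiSym.mul_right' _ hm0 hn0]
    push_cast
    ring

lemma quadGaussSum_four_mul {a : ℤ} (ha : Odd a) {M : ℕ} (hM : 4 ∣ M) :
    quadGaussSum a (4 * M) = 2 * quadGaussSum a M := by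
  obtain ⟨L, rfl⟩ := hM
  rcases eq_or_ne L 0 with rfl | hL
  · simp [quadGaussSum]
  have hL' : (L : ℂ) ≠ 0 := by exact_mod_cast hL
  have hodd : ∑ z ∈ Finset.range (2 * L * 2),
      unitExp (a * ((1 + 2 * z : ℕ) : ℂ) ^ 2 / (4 * (4 * L) : ℕ)) = 0 := by
    rw [Finset.sum_range_mul_eq]
    refine Finset.sum_eq_zero fun y _ => ?_
    rw [Finset.sum_range_succ, Finset.sum_range_one]
    obtain ⟨b, rfl⟩ := ha
    have : unitExp ((2 * b + 1 : ℤ) * ((1 + 2 * (y + 2 * L * 1) : ℕ) : ℂ) ^ 2 / (4 * (4 * L) : ℕ)) =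
        unitExp ((2 * b + 1 : ℤ) * ((1 + 2 * (y + 2 * L * 0) : ℕ) : ℂ) ^ 2 / (4 * (4 * L) : ℕ)
          + 1 / 2) := by
      refine unitExp_eq_of_eq_add_int ((2 * b + 1) * (y + L) + b) ?_
      push_cast
      field_simp
      ring
    rw [this, unitExp_add, unitExp_half]
    ring
  rw [quadGaussSum_eq_sum_unitExp, quadGaussSum_eq_sum_unitExp,
    show Finset.range (4 * (4 * L)) = Finset.range (2 * (2 * L * 2) * 2) by congr 1; ring,
    Finset.sum_range_mul_eq]
  have hshift (y : ℕ) : ∑ z ∈ Finset.range 2,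
      unitExp (a * ((y + 2 * (2 * L * 2) * z : ℕ) : ℂ) ^ 2 / (4 * (4 * L) : ℕ)) =
      2 * unitExp (a * (y : ℂ) ^ 2 / (4 * (4 * L) : ℕ)) := by
    rw [Finset.sum_range_succ, Finset.sum_range_one, two_mul (unitExp _)]
    congr 1
    refine unitExp_eq_of_eq_add_int (a * (y + 4 * L)) ?_
    push_cast
    field_simp
    ring
  rw [Finset.sum_congr rfl fun y _ => hshift y, ← Finset.mul_sum, Finset.sum_range_mul_eq,
    Finset.sum_range_succ, Finset.sum_range_one, hodd, add_zero]
  rw [show 2 * L * 2 = 4 * L by ring]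
  congr 1
  refine Finset.sum_congr rfl fun z _ => ?_
  congr 1
  push_cast
  field_simp
  ring

open Filter Topology

lemma tendsto_jacobiTheta₂_comap_im_atTop (x : ℝ) :
    Tendsto (jacobiTheta₂ x) (comap im atTop) (𝓝 1) := by
  have h1 : (1 : ℂ) = ∑' n : ℤ, if n = 0 then 1 else 0 := by rw [tsum_ite_eq]
  rw [h1]
  have hs := summable_pow_mul_jacobiTheta₂_term_bound 0 one_pos 0
  refine tendsto_tsum_of_dominated_convergence hs (fun n => ?_) ?_
  · rcases eq_or_ne n 0 with rfl | hn
    · simp [jacobiTheta₂_term, tendsto_const_nhds]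
    · rw [if_neg hn, tendsto_zero_iff_norm_tendsto_zero]
      simp only [norm_jacobiTheta₂_term, ofReal_im, mul_zero, sub_zero]
      refine Real.tendsto_exp_atBot.comp (Tendsto.const_mul_atTop_of_neg ?_ tendsto_comap)
      have : (0 : ℝ) < (n : ℝ) ^ 2 := by positivity
      nlinarith [pi_pos]
  · filter_upwards [tendsto_comap.eventually_ge_atTop (1 : ℝ)] with τ hτ n
    rw [pow_zero, one_mul]
    exact norm_jacobiTheta₂_term_le one_pos (by simp) hτ n

lemma jacobiTheta_rat_add (p : ℤ) (q : ℕ) [NeZero q] (hpq : Even (p * q)) {w : ℂ}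
    (hw : 0 < w.im) :
    jacobiTheta (p / q + w) = ∑ r : Fin q, cexp (π * I * p * (r : ℕ) ^ 2 / q) *
      (1 / (-I * (q ^ 2 * w)) ^ (1 / 2 : ℂ) *
        jacobiTheta₂ (((r : ℕ) / q : ℝ) : ℂ) (-1 / (q ^ 2 * w))) := by
  have hq : (q : ℂ) ≠ 0 := by exact_mod_cast NeZero.ne q
  have hw0 : w ≠ 0 := by
    rintro rfl
    simp at hw
  have him : 0 < ((p : ℂ) / q + w).im := by
    have : ((p : ℂ) / q).im = 0 := by
      rw [show (p : ℂ) / q = ((p / q : ℝ) : ℂ) by push_cast; rfl, ofReal_im]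
    rwa [add_im, this, zero_add]
  have hsum : Summable fun x : Fin q × ℤ =>
      jacobiTheta₂_term (x.2 * q + (x.1 : ℕ)) 0 ((p : ℂ) / q + w) :=
    (((Equiv.prodComm (Fin q) ℤ).trans (Int.divModEquiv q).symm).summable_iff).2
      ((summable_jacobiTheta₂_term_iff 0 _).2 him)
  have hterm (r : Fin q) (m : ℤ) :
      jacobiTheta₂_term (m * q + (r : ℕ)) 0 ((p : ℂ) / q + w) =
        cexp (π * I * p * (r : ℕ) ^ 2 / q) * cexp (π * I * (r : ℕ) ^ 2 * w) *
          jacobiTheta₂_term m (q * (r : ℕ) * w) (q ^ 2 * w) := by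
    obtain ⟨K, hK⟩ := hpq
    have hK' : (p : ℂ) * q = K + K := by exact_mod_cast hK
    rw [jacobiTheta₂_term, jacobiTheta₂_term, ← Complex.exp_add, ← Complex.exp_add,
      Complex.exp_eq_exp_iff_exists_int]
    refine ⟨K * m ^ 2 + p * m * (r : ℕ), ?_⟩
    push_cast
    field_simp
    linear_combination (q * m ^ 2 : ℂ) * hK'
  rw [jacobiTheta_eq_jacobiTheta₂, jacobiTheta₂,
    ← ((Equiv.prodComm (Fin q) ℤ).trans (Int.divModEquiv q).symm).tsum_eq]
  change ∑' x : Fin q × ℤ, jacobiTheta₂_term (x.2 * q + (x.1 : ℕ)) 0 ((p : ℂ) / q + w) = _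
  rw [hsum.tsum_prod, tsum_fintype]
  refine Finset.sum_congr rfl fun r _ => ?_
  simp only [hterm]
  rw [tsum_mul_left, ← jacobiTheta₂, jacobiTheta₂_functional_equation]
  have h1 : -π * I * ((q : ℂ) * (r : ℕ) * w) ^ 2 / (q ^ 2 * w) = -(π * I * (r : ℕ) ^ 2 * w) := by
    field_simp
  have h2 : (q : ℂ) * (r : ℕ) * w / (q ^ 2 * w) = (((r : ℕ) / q : ℝ) : ℂ) := by
    push_cast
    field_simp
  rw [h1, h2, Complex.exp_neg]
  have := Complex.exp_ne_zero (π * I * (r : ℕ) ^ 2 * w)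
  field_simp

lemma tendsto_cpow_mul_jacobiTheta_rat_add {ι : Type*} {l : Filter ι} (p : ℤ) (q : ℕ) [NeZero q]
    (hpq : Even (p * q)) {w : ι → ℂ} (hw : ∀ᶠ t in l, 0 < (w t).im)
    (hlim : Tendsto (fun t => (-1 / w t).im) l atTop) :
    Tendsto (fun t => (-I * (q ^ 2 * w t)) ^ (1 / 2 : ℂ) * jacobiTheta (p / q + w t)) l
      (𝓝 (∑ r : Fin q, cexp (π * I * p * (r : ℕ) ^ 2 / q))) := by
  have hq : (q : ℂ) ≠ 0 := by exact_mod_cast NeZero.ne q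
  have hq' : (0 : ℝ) < ((q : ℝ) ^ 2)⁻¹ := by
    have : (0 : ℝ) < q := by exact_mod_cast NeZero.pos q
    positivity
  have hθ (x : ℝ) : Tendsto (fun t => jacobiTheta₂ x (-1 / (q ^ 2 * w t))) l (𝓝 1) := by
    refine (tendsto_jacobiTheta₂_comap_im_atTop x).comp (tendsto_comap_iff.2 ?_)
    refine (hlim.const_mul_atTop hq').congr fun t => ?_
    rw [Function.comp_apply, ← im_ofReal_mul]
    congr 1
    push_cast
    rw [div_mul_eq_div_div_swap]
    ring
  have hsum : Tendsto (fun t => ∑ r : Fin q, cexp (π * I * p * (r : ℕ) ^ 2 / q) *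
      jacobiTheta₂ (((r : ℕ) / q : ℝ) : ℂ) (-1 / (q ^ 2 * w t))) l
      (𝓝 (∑ r : Fin q, cexp (π * I * p * (r : ℕ) ^ 2 / q) * 1)) :=
    tendsto_finsetSum _ fun r _ => (hθ _).const_mul _
  simp only [mul_one] at hsum
  refine hsum.congr' ?_
  filter_upwards [hw] with t ht
  have hw0 : w t ≠ 0 := by
    intro h
    simp [h] at ht
  have h0 : (-I * (q ^ 2 * w t)) ^ (1 / 2 : ℂ) ≠ 0 := by
    simp [Complex.cpow_eq_zero_iff, hq, hw0]
  rw [jacobiTheta_rat_add p q hpq ht, Finset.mul_sum]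
  refine Finset.sum_congr rfl fun r _ => ?_
  generalize (-I * (q ^ 2 * w t)) ^ (1 / 2 : ℂ) = A at h0
  field_simp

lemma ofReal_mul_cpow {x : ℝ} (hx : 0 < x) {z : ℂ} (hz : z ≠ 0) (s : ℂ) :
    ((x : ℂ) * z) ^ s = (x : ℂ) ^ s * z ^ s := by
  have hx' : (x : ℂ) ≠ 0 := by exact_mod_cast hx.ne'
  rw [cpow_def_of_ne_zero (mul_ne_zero hx' hz), cpow_def_of_ne_zero hx', cpow_def_of_ne_zero hz,
    log_ofReal_mul hx hz, ofReal_log hx.le, ← Complex.exp_add, add_mul]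

/-- The reciprocity law `∑_{x < c} e^{2πix²/c} ↔ ∑_{x < 2} e^{-πicx²/2}`, obtained by comparing the
behaviour of Jacobi's theta function near the cusps `2/c` and `-c/2`. -/
lemma cpow_mul_quadGaussSum_one (c : ℕ) [NeZero c] :
    (-I * (2 / c)) ^ (1 / 2 : ℂ) * quadGaussSum 1 c = 1 + cexp (-(π * I * c / 2)) := by
  have hc : (c : ℂ) ≠ 0 := by exact_mod_cast NeZero.ne c
  have hcpos : (0 : ℝ) < c := by exact_mod_cast NeZero.pos c
  set τ : ℝ → ℂ := fun ε => 2 / c + I * ε with hτ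
  set w : ℝ → ℂ := fun ε => c / 2 - 1 / τ ε with hw
  set u : ℝ → ℂ := fun ε => 1 / (1 + c * (I * ε) / 2) with hu
  have hpos : ∀ᶠ ε : ℝ in 𝓝[>] 0, 0 < ε := eventually_mem_nhdsWithin
  have hτim (ε : ℝ) : (τ ε).im = ε := by
    have : ((2 : ℂ) / c).im = 0 := by
      rw [show (2 : ℂ) / c = ((2 / c : ℝ) : ℂ) by push_cast; rfl, ofReal_im]
    simp [hτ, this]
  have hτ0 {ε : ℝ} (hε : 0 < ε) : τ ε ≠ 0 := by
    intro h
    have := hτim ε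
    rw [h, zero_im] at this
    exact hε.ne this
  have huτ (ε : ℝ) : (1 + c * (I * ε) / 2 : ℂ) = c / 2 * τ ε := by
    simp only [hτ]
    field_simp
  have hwu {ε : ℝ} (hε : 0 < ε) : -I * (4 * w ε) = ((c ^ 2 * ε : ℝ) : ℂ) * u ε := by
    have h1 := hτ0 hε
    simp only [hw, hu, huτ]
    field_simp
    simp only [hτ]
    push_cast
    field_simp
    linear_combination (-4 * ε * c : ℂ) * I_sq
  have hneg {ε : ℝ} (hε : 0 < ε) : -1 / w ε = ((4 / c ^ 2 * ε⁻¹ : ℝ) : ℂ) * I - (2 / c : ℝ) := by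
    have h1 := hτ0 hε
    have hε' : (ε : ℂ) ≠ 0 := by exact_mod_cast hε.ne'
    have h2 : w ε = c * I * ε / (2 * τ ε) := by
      simp only [hw]
      field_simp
      simp only [hτ]
      field_simp
      ring
    rw [h2]
    push_cast
    field_simp
    simp only [hτ]
    field_simp
    linear_combination (-4 : ℂ) * I_sq
  have hA := tendsto_cpow_mul_jacobiTheta_rat_add (l := 𝓝[>] (0 : ℝ)) 2 c (even_two.mul_right _)
    (w := fun ε => I * ε) (by filter_upwards [hpos] with ε hε; simpa using hε) (by
      refine tendsto_inv_nhdsGT_zero.congr' ?_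
      filter_upwards [hpos] with ε hε
      rw [show -1 / (I * ε : ℂ) = ((ε⁻¹ : ℝ) : ℂ) * I by
        have : (ε : ℂ) ≠ 0 := by exact_mod_cast hε.ne'
        push_cast
        field_simp
        linear_combination -I_sq]
      simp)
  have hB := tendsto_cpow_mul_jacobiTheta_rat_add (l := 𝓝[>] (0 : ℝ)) (-c) 2
    (by simp) (w := w) (by
      filter_upwards [hpos] with ε hε
      have h1 : ((c : ℂ) / 2).im = 0 := by
        rw [show (c : ℂ) / 2 = ((c / 2 : ℝ) : ℂ) by push_cast; rfl, ofReal_im]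
      have h2 : 0 < normSq (τ ε) := normSq_pos.2 (hτ0 hε)
      simp only [hw, sub_im, h1, one_div, inv_im, hτim]
      have := div_pos hε h2
      rw [neg_div]
      linarith) (by
      refine (tendsto_inv_nhdsGT_zero.const_mul_atTop
        (show (0 : ℝ) < 4 / c ^ 2 by positivity)).congr' ?_
      filter_upwards [hpos] with ε hε
      rw [hneg hε, sub_im, ofReal_im, sub_zero, im_ofReal_mul, I_im, mul_one])
  have hτlim : Tendsto (fun ε => (-I * τ ε) ^ (1 / 2 : ℂ)) (𝓝[>] 0)
      (𝓝 ((-I * (2 / c)) ^ (1 / 2 : ℂ))) := by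
    have h1 : ContinuousAt (fun ε => (-I * τ ε) ^ (1 / 2 : ℂ)) 0 := by
      refine ContinuousAt.cpow (by simp only [hτ]; fun_prop) continuousAt_const ?_
      rw [mem_slitPlane_iff]
      right
      have : (-I * τ 0).im = -(2 / c) := by
        rw [show -I * τ 0 = ((-(2 / c) : ℝ) : ℂ) * I by simp [hτ]; ring, im_ofReal_mul]
        simp
      rw [this]
      have : 0 < 2 / (c : ℝ) := by positivity
      linarith
    have h2 := h1.tendsto.mono_left (nhdsWithin_le_nhds (s := Set.Ioi 0))
    simpa [hτ] using h2
  have hulim : Tendsto (fun ε => u ε ^ (1 / 2 : ℂ)) (𝓝[>] 0) (𝓝 1) := by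
    have h1 : ContinuousAt (fun ε => u ε ^ (1 / 2 : ℂ)) 0 := by
      refine ContinuousAt.cpow ?_ continuousAt_const (by simp [hu])
      simp only [hu]
      refine ContinuousAt.div (by fun_prop) (by fun_prop) (by simp)
    have h2 := h1.tendsto.mono_left (nhdsWithin_le_nhds (s := Set.Ioi 0))
    simpa [hu] using h2
  have hlim := (hulim.mul hτlim).mul hA
  have heq := tendsto_nhds_unique (hlim.congr' ?_) hB
  · rw [one_mul] at heq
    rw [quadGaussSum, Finset.sum_range]
    convert heq using 1
    · congr 1
      refine Finset.sum_congr rfl fun r _ => ?_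
      congr 1
      push_cast
      ring
    · rw [Fin.sum_univ_two]
      simp
      congr 1
      ring
  · filter_upwards [hpos] with ε hε
    have hτne := hτ0 hε
    have hcp : (-I * τ ε) ^ (1 / 2 : ℂ) ≠ 0 := by
      simp [Complex.cpow_eq_zero_iff, hτne]
    have hfe : jacobiTheta (τ ε) = 1 / (-I * τ ε) ^ (1 / 2 : ℂ) * jacobiTheta (-1 / τ ε) := by
      rw [jacobiTheta_eq_jacobiTheta₂, jacobiTheta_eq_jacobiTheta₂,
        jacobiTheta₂_functional_equation]
      simp
    have h1 : ((-c : ℤ) : ℂ) / (2 : ℕ) + w ε = -1 / τ ε := by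
      simp only [hw]
      push_cast
      ring
    have h2 : -I * ((2 : ℕ) ^ 2 * w ε) = ((c ^ 2 * ε : ℝ) : ℂ) * u ε := by
      rw [← hwu hε]
      push_cast
      ring
    have h3 : -I * ((c : ℂ) ^ 2 * (I * ε)) = ((c ^ 2 * ε : ℝ) : ℂ) := by
      push_cast
      linear_combination (-c ^ 2 * ε : ℂ) * I_sq
    have h4 : (((2 : ℤ) : ℂ) / c + I * ε) = τ ε := by simp [hτ]
    have hce : (0 : ℝ) < c ^ 2 * ε := by positivity
    have hu0 : u ε ≠ 0 := by simp [hu, huτ, hc, hτne]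
    rw [h1, h2, h3, h4, hfe, ofReal_mul_cpow hce hu0]
    generalize (-I * τ ε) ^ (1 / 2 : ℂ) = A at hcp
    field_simp

lemma quadGaussSum_one_odd {n : ℕ} (hn : Odd n) :
    quadGaussSum 1 n = epsFactor n * (Real.sqrt n : ℂ) := by
  have hn0 : n ≠ 0 := by
    rintro rfl
    simp at hn
  have : NeZero n := ⟨hn0⟩
  have hnpos : (0 : ℝ) < n := by exact_mod_cast NeZero.pos n
  have h := cpow_mul_quadGaussSum_one n
  have hs : ((Real.sqrt n : ℝ) : ℂ) ^ 2 = n := by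
    rw [← ofReal_pow, Real.sq_sqrt hnpos.le, ofReal_natCast]
  have hs0 : ((Real.sqrt n : ℝ) : ℂ) ≠ 0 := by
    exact_mod_cast (Real.sqrt_pos.2 hnpos).ne'
  have hroot : (-I * (2 / n)) ^ (1 / 2 : ℂ) = (1 - I) / (Real.sqrt n : ℝ) := by
    have h1 : (-I * (2 / n) : ℂ) = ((1 - I) / (Real.sqrt n : ℝ)) ^ 2 := by
      rw [div_pow, hs]
      linear_combination (-1 / n : ℂ) * I_sq
    rw [h1, one_div, Complex.sq_cpow_two_inv]
    rw [div_ofReal_re]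
    simpa using hnpos
  have hexp : cexp (-(π * I * n / 2)) = (-I) ^ n := by
    rw [← Complex.exp_neg_pi_div_two_mul_I, ← Complex.exp_nat_mul]
    congr 1
    ring
  rw [hroot, hexp] at h
  have hval : (1 : ℂ) + (-I) ^ n = (1 - I) * epsFactor n := by
    have h4 : (-I) ^ 4 = 1 := by rw [neg_pow, I_pow_four]; norm_num
    rw [epsFactor, ← Nat.div_add_mod n 4, pow_add, pow_mul, h4, one_pow, one_mul,
      Nat.mul_add_mod, Nat.mod_mod]
    have : n % 4 = 1 ∨ n % 4 = 3 := by
      have := Nat.odd_iff.1 hn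
      omega
    rcases this with h | h <;> rw [h]
    · simp
      ring
    · simp
      linear_combination (1 - I) * I_sq
  rw [hval] at h
  have h1I : (1 - I : ℂ) ≠ 0 := by
    intro h
    simpa using congrArg re h
  field_simp at h
  linear_combination h

lemma quadGaussSum_two_pow {a : ℤ} (ha : Odd a) {k : ℕ} (hk : 2 ≤ k) :
    quadGaussSum a (2 ^ k) = (Real.sqrt (2 ^ k : ℕ) : ℂ) *
      if k % 2 = 0 then 1 + unitExp (a / 4) else (Real.sqrt 2 : ℂ) * unitExp (a / 8) := by
  obtain ⟨k, rfl⟩ := Nat.exists_eq_add_of_le' hk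
  clear hk
  obtain ⟨b, rfl⟩ := ha
  induction k using Nat.twoStepInduction with
  | zero =>
    have h2 : unitExp ((2 * b + 1 : ℤ) * 2 ^ 2 / 4) = 1 := by
      rw [← unitExp_intCast (2 * b + 1)]
      congr 1
      ring
    have h3 : unitExp ((2 * b + 1 : ℤ) * 3 ^ 2 / 4) = unitExp ((2 * b + 1 : ℤ) / 4) :=
      unitExp_eq_of_eq_add_int (2 * (2 * b + 1)) (by push_cast; ring)
    have h0 : unitExp 0 = 1 := by simpa using unitExp_intCast 0
    have hs : Real.sqrt 4 = 2 := by
      rw [show (4 : ℝ) = 2 ^ 2 by norm_num, Real.sqrt_sq zero_le_two]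
    rw [quadGaussSum_eq_sum_unitExp, show 2 ^ (0 + 2) = 4 from rfl]
    simp only [Finset.sum_range_succ, Finset.sum_range_zero, Nat.cast_ofNat, h2, h3, Nat.cast_zero,
      Nat.cast_one, hs]
    simp [h0]
    ring
  | one =>
    have h0 : unitExp 0 = 1 := by simpa using unitExp_intCast 0
    have h2 : unitExp ((2 * b + 1 : ℤ) * 2 ^ 2 / 8) = -1 := by
      rw [← unitExp_half]
      exact unitExp_eq_of_eq_add_int b (by push_cast; ring)
    have h4 : unitExp ((2 * b + 1 : ℤ) * 4 ^ 2 / 8) = 1 := by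
      rw [← h0]
      exact unitExp_eq_of_eq_add_int (2 * (2 * b + 1)) (by push_cast; ring)
    have h6 : unitExp ((2 * b + 1 : ℤ) * 6 ^ 2 / 8) = -1 := by
      rw [← unitExp_half]
      exact unitExp_eq_of_eq_add_int (9 * b + 4) (by push_cast; ring)
    have h3 : unitExp ((2 * b + 1 : ℤ) * 3 ^ 2 / 8) = unitExp ((2 * b + 1 : ℤ) / 8) :=
      unitExp_eq_of_eq_add_int (2 * b + 1) (by push_cast; ring)
    have h5 : unitExp ((2 * b + 1 : ℤ) * 5 ^ 2 / 8) = unitExp ((2 * b + 1 : ℤ) / 8) :=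
      unitExp_eq_of_eq_add_int (3 * (2 * b + 1)) (by push_cast; ring)
    have h7 : unitExp ((2 * b + 1 : ℤ) * 7 ^ 2 / 8) = unitExp ((2 * b + 1 : ℤ) / 8) :=
      unitExp_eq_of_eq_add_int (6 * (2 * b + 1)) (by push_cast; ring)
    have hs : ((Real.sqrt 8 : ℝ) : ℂ) * (Real.sqrt 2 : ℝ) = 4 := by
      rw [← ofReal_mul, ← Real.sqrt_mul (by norm_num),
        show (8 * 2 : ℝ) = 4 ^ 2 by norm_num, Real.sqrt_sq (by norm_num)]
      norm_num
    rw [quadGaussSum_eq_sum_unitExp, show 2 ^ (1 + 2) = 8 from rfl, if_neg (by norm_num),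
      ← mul_assoc]
    simp only [Nat.cast_ofNat, hs]
    simp only [Finset.sum_range_succ, Finset.sum_range_zero, Nat.cast_ofNat, h2, h3, h4, h5, h6, h7,
      Nat.cast_zero, Nat.cast_one]
    simp [h0]
    ring
  | more k ih _ =>
    have h4 : 4 ∣ 2 ^ (k + 2) := by
      rw [pow_add]
      exact dvd_mul_left _ _
    have hs : Real.sqrt (2 ^ (k + 2 + 2) : ℕ) = 2 * Real.sqrt (2 ^ (k + 2) : ℕ) := by
      rw [show ((2 ^ (k + 2 + 2) : ℕ) : ℝ) = 2 ^ 2 * (2 ^ (k + 2) : ℕ) by push_cast; ring,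
        Real.sqrt_mul (by norm_num), Real.sqrt_sq zero_le_two]
    rw [hs, show 2 ^ (k + 2 + 2) = 4 * 2 ^ (k + 2) by ring, quadGaussSum_four_mul ⟨b, rfl⟩ h4, ih,
      Nat.add_mod_right (k + 2) 2]
    push_cast
    ring

/-- evaluation of `G(a/c)` for `c = 2^k c₀`, `k ≥ 2`, `c₀` odd,
`gcd(a,c) = 1`, with `δ = k mod 2`. -/
theorem quadGaussSum_even_modulus (k : ℕ) (hk : 2 ≤ k) (c₀ : ℕ) (hodd : Odd c₀)
    (hpos : 0 < c₀) (a : ℤ) (ha : Int.gcd a ((2 ^ k * c₀ : ℕ) : ℤ) = 1) :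
    quadGaussSum a (2 ^ k * c₀) =
      epsFactor c₀ * (Real.sqrt ((2 ^ k * c₀ : ℕ) : ℝ) : ℂ) *
        ((jacobiSym (a * 2 ^ (k % 2)) c₀ : ℤ) : ℂ) *
        (if k % 2 = 0 then 1 + Complex.exp (2 * Real.pi * Complex.I * a * c₀ / 4)
         else (Real.sqrt 2 : ℂ) * Complex.exp (2 * Real.pi * Complex.I * a * c₀ / 8)) := by
  have hcop : Nat.Coprime (2 ^ k) c₀ := (Nat.coprime_two_left.2 hodd).pow_left k
  have ha' := Int.isCoprime_iff_gcd_eq_one.2 ha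
  push_cast at ha'
  have ha2 : IsCoprime a 2 := (IsCoprime.pow_right_iff (by omega)).1 ha'.of_mul_right_left
  have hac : IsCoprime a c₀ := ha'.of_mul_right_right
  have hao : Odd a := by
    rw [← Int.not_even_iff_odd, even_iff_two_dvd]
    intro h
    exact Int.prime_two.not_isUnit (ha2.isUnit_of_dvd' h dvd_rfl)
  have h2c : IsCoprime (2 : ℤ) c₀ := by
    exact_mod_cast Nat.isCoprime_iff_coprime.2 (Nat.coprime_two_left.2 hodd)
  have hJ : jacobiSym (a * (2 ^ k : ℕ)) c₀ = jacobiSym (a * 2 ^ (k % 2)) c₀ := by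
    push_cast
    conv_lhs => rw [← Nat.div_add_mod k 2]
    rw [pow_add, pow_mul, jacobiSym.mul_left, jacobiSym.mul_left, jacobiSym.mul_left,
      jacobiSym.pow_left (2 ^ 2), jacobiSym.sq_one' (Int.isCoprime_iff_gcd_eq_one.1 h2c), one_pow,
      one_mul]
  have hs : Real.sqrt ((2 ^ k * c₀ : ℕ) : ℝ) = Real.sqrt (2 ^ k : ℕ) * Real.sqrt c₀ := by
    rw [Nat.cast_mul, Real.sqrt_mul (Nat.cast_nonneg _)]
  have he (d : ℂ) : cexp (2 * π * I * a * c₀ / d) = unitExp ((a * c₀ : ℤ) / d) := by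
    rw [unitExp]
    congr 1
    push_cast
    ring
  have hcoprime : IsCoprime (a * (2 ^ k : ℕ)) c₀ := by
    push_cast
    exact hac.mul_left h2c.pow_left
  rw [quadGaussSum_mul a (by positivity) hpos.ne' hcop,
    quadGaussSum_two_pow (hao.mul (by exact_mod_cast hodd)) hk,
    quadGaussSum_eq_jacobiSym_mul hodd hcoprime, hJ, quadGaussSum_one_odd hodd, he, he, hs]
  push_cast
  ring
end

section
/- Let c be a positive integer with 2⁴ | c, and let a, b be integers. Then T(a,b;c) = 0 unless gcd(a,c) = gcd(b,c) and 4 | a and 4 | b (with the convention gcd(0,c) = c). -/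
open Complex Real BigOperators

/-- The additive character `e^{2πi z / c}` of modulus `c`. -/
noncomputable def eModC (c : ℕ) (z : ℤ) : ℂ :=
  Complex.exp (2 * Real.pi * Complex.I * z / c)

/-- The Kloosterman sum `S(m,n;c) = ∑_{x mod c, (x,c)=1} e^{2πi(mx + n x̄)/c}`. -/
noncomputable def kloostermanS (m n : ℤ) (c : ℕ) [NeZero c] : ℂ :=
  ∑ x : (ZMod c)ˣ,
    eModC c (m * (((x : ZMod c)).val : ℤ) + n * ((((x⁻¹ : (ZMod c)ˣ) : ZMod c)).val : ℤ))

/-- `T(a,b;c) = ∑_{x,y mod c} S(x², y²; c) e^{2πi(2xy + ax + by)/c}`. -/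
noncomputable def TabcSum (a b : ℤ) (c : ℕ) [NeZero c] : ℂ :=
  ∑ x ∈ Finset.range c, ∑ y ∈ Finset.range c,
    kloostermanS ((x : ℤ) ^ 2) ((y : ℤ) ^ 2) c *
      eModC c (2 * (x : ℤ) * (y : ℤ) + a * (x : ℤ) + b * (y : ℤ))

lemma eModC_eq_stdAddChar (c : ℕ) [NeZero c] (z : ℤ) :
    eModC c z = ZMod.stdAddChar (z : ZMod c) := by
  rw [ZMod.stdAddChar_coe, eModC]

lemma sum_range_eq_sum_zmod {M : Type*} [AddCommMonoid M] (c : ℕ) [NeZero c] (f : ZMod c → M) :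
    ∑ x ∈ Finset.range c, f x = ∑ x : ZMod c, f x := by
  refine Finset.sum_bij' (fun x _ => (x : ZMod c)) (fun x _ => x.val) ?_ ?_ ?_ ?_ ?_
  · simp
  · intro x _
    simpa using ZMod.val_lt x
  · intro x hx
    exact ZMod.val_cast_of_lt (Finset.mem_range.mp hx)
  · simp
  · simp

/-- Completing the square `d x² + 2xy + d⁻¹ y² = d (x + d⁻¹ y)²` factors the inner sums. -/
lemma TabcSum_eq_sum_units (a b : ℤ) (c : ℕ) [NeZero c] :
    TabcSum a b c = ∑ d : (ZMod c)ˣ,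
      (∑ x : ZMod c, ZMod.stdAddChar (x * ((a : ZMod c) - (b : ZMod c) * (d : ZMod c)))) *
        ∑ z : ZMod c,
          ZMod.stdAddChar ((d : ZMod c) * z ^ 2 + (b : ZMod c) * (d : ZMod c) * z) := by
  have h1 : TabcSum a b c = ∑ x : ZMod c, ∑ y : ZMod c, ∑ d : (ZMod c)ˣ,
      ZMod.stdAddChar ((d : ZMod c) * x ^ 2 + ((d⁻¹ : (ZMod c)ˣ) : ZMod c) * y ^ 2
        + 2 * x * y + (a : ZMod c) * x + (b : ZMod c) * y) := by
    rw [TabcSum, ← sum_range_eq_sum_zmod]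
    refine Finset.sum_congr rfl fun x _ => ?_
    rw [← sum_range_eq_sum_zmod]
    refine Finset.sum_congr rfl fun y _ => ?_
    rw [kloostermanS, Finset.sum_mul]
    refine Finset.sum_congr rfl fun d _ => ?_
    rw [eModC_eq_stdAddChar, eModC_eq_stdAddChar, ← AddChar.map_add_eq_mul]
    congr 1
    push_cast
    rw [ZMod.natCast_zmod_val, ZMod.natCast_zmod_val]
    ring
  rw [h1]
  refine ((Finset.sum_congr rfl fun x _ => Finset.sum_comm).trans Finset.sum_comm).trans ?_
  refine Finset.sum_congr rfl fun d _ => ?_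
  rw [Finset.sum_mul]
  refine Finset.sum_congr rfl fun x _ => ?_
  rw [Finset.mul_sum]
  have hd : (d : ZMod c) * ((d⁻¹ : (ZMod c)ˣ) : ZMod c) = 1 := d.mul_inv
  refine (Fintype.sum_equiv ((Equiv.subRight x).trans d.mulLeft) _ _ fun z => ?_).symm
  rw [← AddChar.map_add_eq_mul]
  congr 1
  simp only [Equiv.trans_apply, Equiv.subRight_apply, Units.mulLeft_apply]
  linear_combination (-(d * (z - x) ^ 2) : ZMod c) * hd

lemma gcd_eq_of_eq_mul_unit {c : ℕ} [NeZero c] {a b : ℤ} (d : (ZMod c)ˣ)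
    (h : (a : ZMod c) = b * (d : ZMod c)) : Int.gcd a c = Int.gcd b c := by
  have hcop : IsCoprime ((d : ZMod c).val : ℤ) (c : ℤ) :=
    Nat.isCoprime_iff_coprime.mpr (ZMod.val_coe_unit_coprime d)
  have h2 : ((a : ℤ) : ZMod c) = ((b * ((d : ZMod c).val : ℤ) : ℤ) : ZMod c) := by
    push_cast
    rw [ZMod.natCast_zmod_val, h]
  rw [ZMod.intCast_eq_intCast_iff] at h2
  rw [← Int.gcd_emod, h2, Int.gcd_emod, Int.gcd_mul_left_left_of_gcd_eq_one]
  exact Int.isCoprime_iff_gcd_eq_one.mp hcop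

lemma zmod_even_or_odd {c : ℕ} [NeZero c] (z : ZMod c) : Even z ∨ Odd z := by
  rw [← ZMod.natCast_zmod_val z]
  exact (Nat.even_or_odd z.val).imp (fun h => h.natCast) (fun h => h.natCast)

lemma odd_unit {c : ℕ} [NeZero c] (hc : 2 ∣ c) (d : (ZMod c)ˣ) : Odd (d : ZMod c) := by
  rw [← ZMod.natCast_zmod_val (d : ZMod c)]
  have h := (ZMod.val_coe_unit_coprime d).coprime_dvd_right hc
  exact (Nat.coprime_two_right.mp h).natCast

lemma sixteen_mul_cast_eq_zero {c k : ℕ} (hk : c = 16 * k) : 16 * (k : ZMod c) = 0 := by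
  have h : ((16 * k : ℕ) : ZMod c) = 0 := (ZMod.natCast_eq_zero_iff _ _).mpr hk.dvd
  exact_mod_cast h

lemma stdAddChar_half {c k : ℕ} [NeZero c] (hk : c = 16 * k) :
    ZMod.stdAddChar (8 * (k : ZMod c)) = -1 := by
  have hk0 : (k : ℂ) ≠ 0 := by
    have := NeZero.ne c
    exact_mod_cast (by omega : k ≠ 0)
  have : (8 * (k : ZMod c)) = ((8 * k : ℤ) : ZMod c) := by push_cast; rfl
  rw [this, ZMod.stdAddChar_coe, ← Complex.exp_pi_mul_I, hk]
  congr 1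
  push_cast
  field_simp
  norm_num

lemma sum_eq_zero_of_equiv_neg {G : Type*} [Fintype G] (f : G → ℂ) (e : G ≃ G)
    (h : ∀ y, f (e y) = -f y) : ∑ y, f y = 0 := by
  have h1 := Equiv.sum_comp e f
  simp only [h, Finset.sum_neg_distrib] at h1
  exact self_eq_neg.mp h1.symm

/-- The linear coefficient `b` being odd, shifting by `c / 2` negates the Gauss sum. -/
lemma gaussSum_odd_eq_zero {c k : ℕ} [NeZero c] (hk : c = 16 * k) {b : ZMod c} (hb : Odd b)
    (d : (ZMod c)ˣ) :
    ∑ z : ZMod c, ZMod.stdAddChar ((d : ZMod c) * z ^ 2 + b * (d : ZMod c) * z) = 0 := by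
  have hr := sixteen_mul_cast_eq_zero hk
  obtain ⟨m, hm⟩ := hb.mul (odd_unit (by omega) d)
  refine sum_eq_zero_of_equiv_neg _ (Equiv.addRight (8 * (k : ZMod c))) fun z => ?_
  rw [Equiv.coe_addRight]
  rw [← neg_one_mul, ← stdAddChar_half hk, ← AddChar.map_add_eq_mul]
  congr 1
  linear_combination (d * (z + 4 * k) : ZMod c) * hr + (8 * k : ZMod c) * hm + m * hr

/-- Shifting by `c / 4` kills the contribution of the odd residues to a quadratic Gauss sum. -/
lemma gaussSum_add_half {c k : ℕ} [NeZero c] (hk : c = 16 * k) (d : (ZMod c)ˣ) :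
    ∑ z : ZMod c, ZMod.stdAddChar (((d : ZMod c) + 8 * (k : ZMod c)) * z ^ 2) =
      ∑ z : ZMod c, ZMod.stdAddChar ((d : ZMod c) * z ^ 2) := by
  have hr := sixteen_mul_cast_eq_zero hk
  obtain ⟨e, he⟩ := odd_unit (by omega) d
  rw [← sub_eq_zero, ← Finset.sum_sub_distrib]
  refine sum_eq_zero_of_equiv_neg _ (Equiv.addRight (4 * (k : ZMod c))) fun z => ?_
  rw [Equiv.coe_addRight]
  rcases zmod_even_or_odd z with ⟨m, rfl⟩ | ⟨m, rfl⟩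
  · have h1 : ((d : ZMod c) + 8 * k) * (m + m) ^ 2 = d * (m + m) ^ 2 := by
      linear_combination (2 * m ^ 2 : ZMod c) * hr
    have h2 : ((d : ZMod c) + 8 * k) * (m + m + 4 * k) ^ 2 = d * (m + m + 4 * k) ^ 2 := by
      linear_combination (2 * (m + 2 * k) ^ 2 : ZMod c) * hr
    rw [h1, h2]
    simp
  · have h1 : ((d : ZMod c) + 8 * k) * (2 * m + 1) ^ 2 = 8 * k + d * (2 * m + 1) ^ 2 := by
      linear_combination (2 * m ^ 2 + 2 * m : ZMod c) * hr
    have h2 : (d : ZMod c) * (2 * m + 1 + 4 * k) ^ 2 = 8 * k + d * (2 * m + 1) ^ 2 := by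
      linear_combination (d * (m + k) + e : ZMod c) * hr + (8 * k : ZMod c) * he
    have h3 : ((d : ZMod c) + 8 * k) * (2 * m + 1 + 4 * k) ^ 2 = d * (2 * m + 1) ^ 2 := by
      linear_combination h2 + (2 * (m + 2 * k) ^ 2 + 2 * (m + 2 * k) + 1 : ZMod c) * hr
    rw [h1, h2, h3]
    ring

lemma gaussSum_complete_square {c : ℕ} [NeZero c] (d m : ZMod c) :
    ∑ z : ZMod c, ZMod.stdAddChar (d * z ^ 2 + 2 * m * d * z) =
      ZMod.stdAddChar (-(d * m ^ 2)) * ∑ z : ZMod c, ZMod.stdAddChar (d * z ^ 2) := by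
  rw [Finset.mul_sum]
  refine Fintype.sum_equiv (Equiv.addRight m) _ _ fun z => ?_
  rw [← AddChar.map_add_eq_mul]
  congr 1
  simp only [Equiv.coe_addRight]
  ring

/-- For `b = 2m` with `m` odd, the substitution `d ↦ d + c / 2` negates the sum over units. -/
lemma sum_units_eq_zero {c k : ℕ} [NeZero c] (hk : c = 16 * k) (a : ZMod c) {m : ZMod c}
    (hm : Odd m) :
    ∑ d : (ZMod c)ˣ, (∑ x : ZMod c, ZMod.stdAddChar (x * (a - 2 * m * (d : ZMod c)))) *
        ∑ z : ZMod c, ZMod.stdAddChar ((d : ZMod c) * z ^ 2 + 2 * m * (d : ZMod c) * z) = 0 := by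
  have hr := sixteen_mul_cast_eq_zero hk
  have hw : (1 + 8 * (k : ZMod c)) * (1 + 8 * k) = 1 := by
    linear_combination (1 + 4 * k : ZMod c) * hr
  let w : (ZMod c)ˣ := ⟨1 + 8 * k, 1 + 8 * k, hw, hw⟩
  have hmul (d : (ZMod c)ˣ) : ((d * w : (ZMod c)ˣ) : ZMod c) = d + 8 * k := by
    obtain ⟨e, he⟩ := odd_unit (by omega) d
    change (d : ZMod c) * (1 + 8 * k) = d + 8 * k
    linear_combination (8 * k : ZMod c) * he + e * hr
  refine sum_eq_zero_of_equiv_neg _ (Equiv.mulRight w) fun d => ?_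
  simp only [Equiv.coe_mulRight, gaussSum_complete_square, hmul, gaussSum_add_half hk]
  have h1 : 2 * m * ((d : ZMod c) + 8 * (k : ZMod c)) = 2 * m * d := by
    linear_combination m * hr
  have h2 : ZMod.stdAddChar (-(((d : ZMod c) + 8 * (k : ZMod c)) * m ^ 2)) =
      -ZMod.stdAddChar (-((d : ZMod c) * m ^ 2)) := by
    obtain ⟨n, rfl⟩ := hm
    rw [← neg_one_mul (ZMod.stdAddChar _), ← stdAddChar_half hk, ← AddChar.map_add_eq_mul]
    congr 1
    linear_combination (-(2 * n ^ 2 + 2 * n + 1) : ZMod c) * hr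
  rw [h1, h2]
  ring

/-- if `2⁴ | c`, then `T(a,b;c) = 0` unless
`gcd(a,c) = gcd(b,c)`, `4 | a` and `4 | b`. -/
theorem TabcSum_eq_zero (c : ℕ) [NeZero c] (hc : 2 ^ 4 ∣ c) (a b : ℤ)
    (h : ¬ (Int.gcd a (c : ℤ) = Int.gcd b (c : ℤ) ∧ (4 : ℤ) ∣ a ∧ (4 : ℤ) ∣ b)) :
    TabcSum a b c = 0 := by
  rw [TabcSum_eq_sum_units]
  obtain ⟨k, hk⟩ := hc
  norm_num at hk
  by_cases hg : Int.gcd a c = Int.gcd b c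
  · have hb : ¬ (4 : ℤ) ∣ b := fun hb => h ⟨hg, by
      have h4 : (4 : ℤ) ∣ Int.gcd b c := Int.dvd_coe_gcd hb (by omega)
      rw [← hg] at h4
      exact h4.trans (Int.gcd_dvd_left ..), hb⟩
    rcases Int.even_or_odd' b with ⟨m, rfl | rfl⟩
    · have hm : Odd (m : ZMod c) :=
        (Int.not_even_iff_odd.mp fun ⟨n, hn⟩ => hb ⟨n, by omega⟩).intCast
      have := sum_units_eq_zero hk (a : ZMod c) hm
      push_cast
      exact this
    · refine Finset.sum_eq_zero fun d _ => ?_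
      rw [gaussSum_odd_eq_zero hk ⟨(m : ZMod c), by push_cast; rfl⟩, mul_zero]
  · refine Finset.sum_eq_zero fun d _ => ?_
    rw [AddChar.sum_mulShift _ (ZMod.isPrimitive_stdAddChar c), if_neg, Nat.cast_zero, zero_mul]
    exact fun h0 => hg (gcd_eq_of_eq_mul_unit d (sub_eq_zero.mp h0))
end
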